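/- arXiv:1602.07018 — 8 statements merged into one kernel-verified Lean document; each statement's English description precedes it below -/
import Mathlib

section
/- Let x* ∈ ℝⁿ. Then x* is a global minimizer of F if and only if for every index i the following hold: if x*_i > 0 then ∇f(x*)_i = −λ; if x*_i < 0 then ∇f(x*)_i = λ; and if x*_i = 0 then |∇f(x*)_i| ≤ λ. -/
open Filter Finset

/-- sign function: 1 if positive, -1 if negative, 0 if zero. -/
noncomputable def sgn (t : ℝ) : ℝ := if 0 < t then 1 else if t < 0 then -1 else 0

/-- the component of the optimality measure `β` for the zero variables,
given the regularization weight `lam`, the gradient component `gi` and the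
variable component `xi`. -/
noncomputable def betaC (lam gi xi : ℝ) : ℝ :=
  if xi = 0 ∧ gi + lam < 0 then gi + lam
  else if xi = 0 ∧ 0 < gi - lam then gi - lam
  else 0

/-- the component of the optimality measure `φ` for the nonzero variables. -/
noncomputable def phiC (lam gi xi : ℝ) : ℝ :=
  if xi = 0 then 0
  else if 0 < xi ∧ 0 < gi + lam then min (gi + lam) (max xi (gi - lam))
  else if xi < 0 ∧ gi - lam < 0 then max (gi - lam) (min xi (gi + lam))
  else gi + lam * sgn xi

/-- The derivative of a differentiable function along a line, in coordinates of its gradient. -/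
theorem hasDerivAt_line_gradient {n : ℕ} {f : EuclideanSpace ℝ (Fin n) → ℝ}
    {x : EuclideanSpace ℝ (Fin n)} (hf : DifferentiableAt ℝ f x)
    (v : EuclideanSpace ℝ (Fin n)) :
    HasDerivAt (fun t : ℝ => f (x + t • v)) (∑ i, gradient f x i * v i) 0 := by
  have hline : HasDerivAt (fun t : ℝ => x + t • v) v 0 := by
    simpa using ((hasDerivAt_id (0 : ℝ)).smul_const v).const_add x
  have hgrad : HasFDerivAt f (InnerProductSpace.toDual ℝ _ (gradient f x)) (x + (0 : ℝ) • v) := by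
    simpa using hf.hasGradientAt.hasFDerivAt
  have h := hgrad.comp_hasDerivAt (0 : ℝ) hline
  rw [InnerProductSpace.toDual_apply_apply, PiLp.inner_apply] at h
  simpa [Function.comp_def, mul_comm] using h

/-- The first-order lower bound for a differentiable convex function. -/
theorem ConvexOn.add_sum_gradient_mul_le {n : ℕ} {f : EuclideanSpace ℝ (Fin n) → ℝ}
    (hconv : ConvexOn ℝ Set.univ f) {x : EuclideanSpace ℝ (Fin n)}
    (hf : DifferentiableAt ℝ f x) (y : EuclideanSpace ℝ (Fin n)) :
    f x + ∑ i, gradient f x i * (y i - x i) ≤ f y := by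
  have hline : ConvexOn ℝ Set.univ (fun t : ℝ => f (x + t • (y - x))) := by
    have h := hconv.comp_affineMap (AffineMap.lineMap x y : ℝ →ᵃ[ℝ] EuclideanSpace ℝ (Fin n))
    simpa [Function.comp_def, AffineMap.lineMap_apply, add_comm] using h
  have h := hline.le_slope_of_hasDerivAt (Set.mem_univ 0) (Set.mem_univ 1) one_pos
    (hasDerivAt_line_gradient hf (y - x))
  simp [slope_def_field] at h
  linarith

/-- A linear lower bound to the right of `0` bounds the derivative at `0` from below. -/
theorem HasDerivAt.neg_le_of_sub_mul_le {g : ℝ → ℝ} {a c : ℝ} (hg : HasDerivAt g a 0)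
    (h : ∀ t, 0 < t → g 0 - c * t ≤ g t) : -c ≤ a := by
  have hslope := hasDerivWithinAt_iff_tendsto_slope.mp (hg.hasDerivWithinAt (s := Set.Ioi 0))
  rw [Set.sdiff_singleton_eq_self (by simp)] at hslope
  refine ge_of_tendsto hslope ?_
  filter_upwards [self_mem_nhdsWithin] with t ht
  have ht : 0 < t := ht
  rw [slope_def_field, sub_zero, le_div_iff₀ ht]
  linarith [h t ht]

/-- `x*` is a global minimizer of `F = f + λ‖·‖₁` iff for each `i`:
`x*_i > 0 → ∇f(x*)_i = -λ`, `x*_i < 0 → ∇f(x*)_i = λ`, and `x*_i = 0 → |∇f(x*)_i| ≤ λ`. -/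
theorem stmt0 (n : ℕ) (hn : 1 ≤ n)
    (f : EuclideanSpace ℝ (Fin n) → ℝ)
    (hconv : ConvexOn ℝ Set.univ f) (hdiff : Differentiable ℝ f)
    (lam : ℝ) (hlam : 0 < lam)
    (F : EuclideanSpace ℝ (Fin n) → ℝ)
    (hF : ∀ x, F x = f x + lam * ∑ i, |x i|)
    (xs : EuclideanSpace ℝ (Fin n)) :
    (∀ x, F xs ≤ F x) ↔
      ∀ i : Fin n,
        (0 < xs i → gradient f xs i = -lam) ∧
        (xs i < 0 → gradient f xs i = lam) ∧
        (xs i = 0 → |gradient f xs i| ≤ lam) := by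
  constructor
  · intro hmin i
    have hd : HasDerivAt (fun t : ℝ => f (xs + t • EuclideanSpace.single i 1))
        (gradient f xs i) 0 := by
      simpa [Pi.single_apply] using
        hasDerivAt_line_gradient (hdiff xs) (EuclideanSpace.single i (1 : ℝ))
    have hle : ∀ t : ℝ, f xs + lam * |xs i| ≤
        f (xs + t • EuclideanSpace.single i 1) + lam * |xs i + t| := by
      intro t
      have h := hmin (xs + t • EuclideanSpace.single i 1)
      rw [hF, hF, ← Finset.add_sum_erase _ _ (Finset.mem_univ i),
        ← Finset.add_sum_erase _ _ (Finset.mem_univ i)] at h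
      have hrest : ∑ j ∈ Finset.univ.erase i, |(xs + t • EuclideanSpace.single i (1 : ℝ)) j| =
          ∑ j ∈ Finset.univ.erase i, |xs j| := by
        refine Finset.sum_congr rfl fun j hj => ?_
        simp [Finset.ne_of_mem_erase hj]
      rw [hrest] at h
      simp only [PiLp.add_apply, PiLp.smul_apply, PiLp.single_apply, if_true,
        smul_eq_mul, mul_one] at h
      linarith
    have hcrit : ∀ s : ℝ, HasDerivAt (fun u : ℝ => |u|) s (xs i) →
        gradient f xs i + lam * s = 0 := by
      intro s hs
      have habs : HasDerivAt (fun t : ℝ => |xs i + t|) s 0 :=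
        HasDerivAt.comp_const_add (xs i) 0 (by simpa using hs)
      refine IsLocalMin.hasDerivAt_eq_zero ?_ (hd.add (habs.const_mul lam))
      exact Eventually.of_forall fun t => by simpa using hle t
    refine ⟨fun hpos => ?_, fun hneg => ?_, fun hzero => ?_⟩
    · linarith [hcrit 1 (hasDerivAt_abs_pos hpos)]
    · linarith [hcrit (-1) (hasDerivAt_abs_neg hneg)]
    · simp only [hzero, abs_zero, mul_zero, add_zero, zero_add] at hle
      rw [abs_le]
      constructor
      · refine hd.neg_le_of_sub_mul_le fun t ht => ?_
        have h := hle t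
        rw [abs_of_pos ht] at h
        simp only [zero_smul, add_zero]
        linarith
      · have hd' : HasDerivAt (fun t : ℝ => f (xs + (-t) • EuclideanSpace.single i 1))
            (-gradient f xs i) 0 := by
          have hd₀ : HasDerivAt (fun t : ℝ => f (xs + t • EuclideanSpace.single i 1))
              (gradient f xs i) (-0) := by rwa [neg_zero]
          have h := hd₀.comp (0 : ℝ) (hasDerivAt_neg (0 : ℝ))
          rwa [mul_neg_one] at h
        refine neg_le_neg_iff.mp (hd'.neg_le_of_sub_mul_le fun t ht => ?_)
        have h := hle (-t)
        rw [abs_neg, abs_of_pos ht] at h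
        simp only [neg_zero, zero_smul, add_zero]
        linarith
  · intro hopt x
    have hfirst := hconv.add_sum_gradient_mul_le (hdiff xs) x
    have hsum : ∑ i, lam * |xs i| ≤
        ∑ i, (gradient f xs i * (x i - xs i) + lam * |x i|) := by
      refine Finset.sum_le_sum fun i _ => ?_
      obtain ⟨hpos, hneg, hzero⟩ := hopt i
      rcases lt_trichotomy (xs i) 0 with h | h | h
      · rw [hneg h, abs_of_neg h]
        nlinarith [neg_abs_le (x i)]
      · have hmul : |gradient f xs i * x i| ≤ lam * |x i| := by
          rw [abs_mul]
          exact mul_le_mul_of_nonneg_right (hzero h) (abs_nonneg _)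
        rw [h, abs_zero, mul_zero, sub_zero]
        linarith [neg_abs_le (gradient f xs i * x i)]
      · rw [hpos h, abs_of_pos h]
        nlinarith [le_abs_self (x i)]
    rw [Finset.sum_add_distrib, ← Finset.mul_sum, ← Finset.mul_sum] at hsum
    rw [hF, hF]
    linarith
end

section
/- A point x* ∈ ℝⁿ is a global minimizer of F if and only if β(x*) = 0 and φ(x*) = 0. -/
open Filter Finset

/-- The one-sided difference quotients of a differentiable function along a direction converge to
the inner product of the gradient with that direction. -/
theorem tendsto_diffQuot_inner_gradient {E : Type*} [NormedAddCommGroup E]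
    [InnerProductSpace ℝ E] [CompleteSpace E] {f : E → ℝ} {x : E}
    (hf : DifferentiableAt ℝ f x) (v : E) :
    Tendsto (fun s : ℝ => s⁻¹ * (f (x + s • v) - f x)) (nhdsWithin 0 (Set.Ioi 0))
      (nhds (inner ℝ (gradient f x) v)) := by
  have hline : HasLineDerivAt ℝ f (inner ℝ (gradient f x) v) x v := by
    simpa using hf.hasGradientAt.hasFDerivAt.hasLineDerivAt v
  simpa using hline.tendsto_slope_zero_right

theorem ConvexOn.add_inner_gradient_le {E : Type*} [NormedAddCommGroup E]
    [InnerProductSpace ℝ E] [CompleteSpace E] {f : E → ℝ} (hconv : ConvexOn ℝ Set.univ f) {x : E}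
    (hf : DifferentiableAt ℝ f x) (y : E) :
    f x + inner ℝ (gradient f x) (y - x) ≤ f y := by
  suffices h : inner ℝ (gradient f x) (y - x) ≤ f y - f x by linarith
  refine le_of_tendsto (tendsto_diffQuot_inner_gradient hf (y - x)) ?_
  filter_upwards [Ioo_mem_nhdsGT (zero_lt_one' ℝ)] with s hs
  have hc := hconv.2 (Set.mem_univ x) (Set.mem_univ y) (sub_nonneg.2 hs.2.le) hs.1.le
    (sub_add_cancel 1 s)
  rw [show (1 - s) • x + s • y = x + s • (y - x) by module] at hc
  simp only [smul_eq_mul] at hc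
  rw [inv_mul_le_iff₀ hs.1]
  linarith

theorem betaC_eq_zero_and_phiC_eq_zero_iff {lam : ℝ} (_ : 0 < lam) (g x : ℝ) :
    betaC lam g x = 0 ∧ phiC lam g x = 0 ↔
      (x = 0 ∧ -lam ≤ g ∧ g ≤ lam) ∨ (0 < x ∧ g = -lam) ∨ (x < 0 ∧ g = lam) := by
  unfold betaC phiC sgn
  grind

theorem forall_abs_le_iff {lam : ℝ} (hlam : 0 < lam) (g x : ℝ) :
    (∀ t, lam * |x| ≤ lam * |t| + g * (t - x)) ↔
      (x = 0 ∧ -lam ≤ g ∧ g ≤ lam) ∨ (0 < x ∧ g = -lam) ∨ (x < 0 ∧ g = lam) := by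
  constructor
  · intro h
    rcases lt_trichotomy x 0 with hx | rfl | hx
    · have h0 := h 0
      have h2 := h (2 * x)
      rw [abs_of_neg hx, abs_zero] at h0
      rw [abs_of_neg hx, abs_of_neg (by linarith)] at h2
      exact Or.inr (Or.inr ⟨hx, by nlinarith⟩)
    · have h1 := h 1
      have h2 := h (-1)
      norm_num at h1 h2
      exact Or.inl ⟨rfl, by linarith, by linarith⟩
    · have h0 := h 0
      have h2 := h (2 * x)
      rw [abs_of_pos hx, abs_zero] at h0
      rw [abs_of_pos hx, abs_of_pos (by linarith)] at h2
      exact Or.inr (Or.inl ⟨hx, by nlinarith⟩)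
  · rintro (⟨rfl, h1, h2⟩ | ⟨hx, rfl⟩ | ⟨hx, rfl⟩) t
    · have h := neg_abs_le (g * t)
      rw [abs_mul] at h
      have := mul_le_mul_of_nonneg_right (abs_le.2 ⟨h1, h2⟩) (abs_nonneg t)
      simp only [abs_zero, mul_zero, sub_zero]
      linarith
    · rw [abs_of_pos hx]
      nlinarith [le_abs_self t]
    · rw [abs_of_neg hx]
      nlinarith [neg_abs_le t]

/-- `x*` is a global minimizer of `F = f + λ‖·‖₁` iff `β(x*) = 0` and `φ(x*) = 0`. -/
theorem stmt1 (n : ℕ) (hn : 1 ≤ n)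
    (f : EuclideanSpace ℝ (Fin n) → ℝ)
    (hconv : ConvexOn ℝ Set.univ f) (hdiff : Differentiable ℝ f)
    (lam : ℝ) (hlam : 0 < lam)
    (F : EuclideanSpace ℝ (Fin n) → ℝ)
    (hF : ∀ x, F x = f x + lam * ∑ i, |x i|)
    (xs : EuclideanSpace ℝ (Fin n)) :
    (∀ x, F xs ≤ F x) ↔
      ∀ i : Fin n,
        betaC lam (gradient f xs i) (xs i) = 0 ∧
        phiC lam (gradient f xs i) (xs i) = 0 := by
  simp_rw [betaC_eq_zero_and_phiC_eq_zero_iff hlam, ← forall_abs_le_iff hlam]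
  constructor
  · intro hmin i t
    have hlim := tendsto_diffQuot_inner_gradient (hdiff xs) (EuclideanSpace.single i (t - xs i))
    suffices h : lam * (|xs i| - |t|) ≤
        inner ℝ (gradient f xs) (EuclideanSpace.single i (t - xs i)) by
      rw [EuclideanSpace.inner_single_right, conj_trivial, mul_comm (t - xs i)] at h
      linarith
    refine ge_of_tendsto hlim ?_
    filter_upwards [Ioo_mem_nhdsGT (zero_lt_one' ℝ)] with s hs
    have h := hmin (xs + s • EuclideanSpace.single i (t - xs i))
    rw [hF, hF] at h
    have hsum : ∑ j, |(xs + s • EuclideanSpace.single i (t - xs i)) j| - ∑ j, |xs j| =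
        |xs i + s * (t - xs i)| - |xs i| := by
      rw [← Finset.sum_sub_distrib, Finset.sum_eq_single i]
      · simp
      · intro j _ hj
        simp [hj]
      · simp
    have habs : |xs i + s * (t - xs i)| ≤ (1 - s) * |xs i| + s * |t| := by
      rw [show xs i + s * (t - xs i) = (1 - s) * xs i + s * t by ring]
      refine (abs_add_le _ _).trans_eq ?_
      rw [abs_mul, abs_mul, abs_of_pos hs.1, abs_of_pos (sub_pos.2 hs.2)]
    rw [le_inv_mul_iff₀ hs.1]
    have := mul_le_mul_of_nonneg_left habs hlam.le
    rw [sub_eq_iff_eq_add] at hsum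
    rw [hsum] at h
    linarith
  · intro h y
    have hgrad := hconv.add_inner_gradient_le (hdiff xs) y
    have hsum := Finset.sum_le_sum fun i (_ : i ∈ Finset.univ) => h i (y i)
    rw [Finset.sum_add_distrib, ← Finset.mul_sum, ← Finset.mul_sum] at hsum
    have hinner : inner ℝ (gradient f xs) (y - xs) =
        ∑ i, gradient f xs i * (y i - xs i) := by
      simp only [PiLp.inner_apply, PiLp.sub_apply, RCLike.inner_apply, conj_trivial, mul_comm]
    rw [hF, hF]
    linarith
end

section
/- Let {x_k} be a sequence in ℝⁿ converging to x*. If x* is a global minimizer of F, then β(x_k) → 0 and φ(x_k) → 0 as k → ∞. -/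
open Filter Finset

/-- A function whose right difference quotients at `0` are bounded below by `-c` has derivative
at least `-c` there. -/
theorem HasDerivAt.add_nonneg_of_eventually_le {h : ℝ → ℝ} {g c : ℝ} (hd : HasDerivAt h g 0)
    (hc : ∀ᶠ t in nhdsWithin 0 (Set.Ioi 0), h 0 ≤ h t + c * t) : 0 ≤ g + c := by
  have hs := (hasDerivAt_iff_tendsto_slope_zero.1 hd).mono_left
    (nhdsWithin_mono (0 : ℝ) fun t (ht : t ∈ Set.Ioi 0) => ne_of_gt ht)
  refine ge_of_tendsto (hs.add_const c) ?_
  filter_upwards [hc, self_mem_nhdsWithin] with t ht (ht0 : 0 < t)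
  have hq : t⁻¹ • (h (0 + t) - h 0) + c = t⁻¹ * (h t + c * t - h 0) := by
    simp only [zero_add, smul_eq_mul]
    field_simp
    ring
  rw [hq]
  exact mul_nonneg (inv_nonneg.2 ht0.le) (sub_nonneg.2 ht)

/-- First-order optimality conditions in one variable for a function penalized by `lam * |·|`. -/
theorem HasDerivAt.optimality_of_abs_penalty {h : ℝ → ℝ} {g a lam : ℝ} (hlam : 0 < lam)
    (hd : HasDerivAt h g 0) (hmin : ∀ t, h 0 + lam * |a| ≤ h t + lam * |a + t|) :
    -lam ≤ g ∧ g ≤ lam ∧ (0 < a → g = -lam) ∧ (a < 0 → g = lam) := by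
  have hdn : HasDerivAt (fun t => h (-t)) (-g) 0 := by
    have := HasDerivAt.comp (h₂ := h) (h₂' := g) (0 : ℝ) (by simpa using hd) (hasDerivAt_neg (0 : ℝ))
    simpa [Function.comp_def] using this
  have hpos : ∀ c, (∀ᶠ t in nhdsWithin (0 : ℝ) (Set.Ioi 0), |a + t| ≤ |a| + c * t) →
      0 ≤ g + lam * c := fun c hc => hd.add_nonneg_of_eventually_le <| by
    filter_upwards [hc] with t ht
    nlinarith [hmin t, mul_le_mul_of_nonneg_left ht hlam.le]
  have hneg : ∀ c, (∀ᶠ t in nhdsWithin (0 : ℝ) (Set.Ioi 0), |a + -t| ≤ |a| + c * t) →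
      0 ≤ -g + lam * c := fun c hc => hdn.add_nonneg_of_eventually_le <| by
    filter_upwards [hc] with t ht
    rw [neg_zero]
    nlinarith [hmin (-t), mul_le_mul_of_nonneg_left ht hlam.le]
  have h1 : 0 ≤ g + lam * 1 := hpos 1 <| by
    filter_upwards [self_mem_nhdsWithin] with t (ht : 0 < t)
    linarith [abs_add_le a t, abs_of_pos ht]
  have h2 : 0 ≤ -g + lam * 1 := hneg 1 <| by
    filter_upwards [self_mem_nhdsWithin] with t (ht : 0 < t)
    linarith [abs_add_le a (-t), abs_neg t, abs_of_pos ht]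
  refine ⟨by linarith, by linarith, fun ha => ?_, fun ha => ?_⟩
  · have h3 : 0 ≤ -g + lam * (-1) := hneg (-1) <| by
      filter_upwards [Ioo_mem_nhdsGT ha] with t ht
      rw [abs_of_pos ha, abs_of_pos (by linarith [ht.2])]
      linarith
    linarith
  · have h3 : 0 ≤ g + lam * (-1) := hpos (-1) <| by
      filter_upwards [Ioo_mem_nhdsGT (neg_pos.2 ha)] with t ht
      rw [abs_of_neg ha, abs_of_neg (by linarith [ht.2])]
      linarith
    linarith

theorem DifferentiableAt.hasDerivAt_add_single {n : ℕ} {f : EuclideanSpace ℝ (Fin n) → ℝ}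
    {x : EuclideanSpace ℝ (Fin n)} (hf : DifferentiableAt ℝ f x) (i : Fin n) :
    HasDerivAt (fun t : ℝ => f (x + t • EuclideanSpace.single i (1 : ℝ))) (gradient f x i) 0 := by
  have hl := hf.hasFDerivAt.hasLineDerivAt (EuclideanSpace.single i (1 : ℝ))
  have hg : fderiv ℝ f x (EuclideanSpace.single i 1) = gradient f x i := by
    rw [hf.hasGradientAt.hasFDerivAt.fderiv, InnerProductSpace.toDual_apply_apply,
      EuclideanSpace.inner_single_right]
    simp
  rw [← hg]
  exact hl

theorem ContDiff.continuous_gradient {E : Type*} [NormedAddCommGroup E] [InnerProductSpace ℝ E]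
    [CompleteSpace E] {f : E → ℝ} (hf : ContDiff ℝ 1 f) : Continuous (gradient f) :=
  (InnerProductSpace.toDual ℝ E).symm.continuous.comp (hf.continuous_fderiv one_ne_zero)

/-- Coordinatewise first-order optimality conditions for a minimizer of `f + lam * ‖·‖₁`. -/
theorem gradient_optimality_of_l1_penalty {n : ℕ} {f : EuclideanSpace ℝ (Fin n) → ℝ} {lam : ℝ}
    (hlam : 0 < lam) {x : EuclideanSpace ℝ (Fin n)} (hf : DifferentiableAt ℝ f x)
    (hmin : ∀ z : EuclideanSpace ℝ (Fin n), f x + lam * ∑ i, |x i| ≤ f z + lam * ∑ i, |z i|)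
    (i : Fin n) :
    -lam ≤ gradient f x i ∧ gradient f x i ≤ lam ∧
      (0 < x i → gradient f x i = -lam) ∧ (x i < 0 → gradient f x i = lam) := by
  refine (hf.hasDerivAt_add_single i).optimality_of_abs_penalty hlam fun t => ?_
  have h := hmin (x + t • EuclideanSpace.single i (1 : ℝ))
  rw [← add_sum_erase _ _ (mem_univ i), ← add_sum_erase univ _ (mem_univ i)] at h
  have hs : ∑ j ∈ univ.erase i, |(x + t • EuclideanSpace.single i (1 : ℝ)) j| =
      ∑ j ∈ univ.erase i, |x j| :=
    sum_congr rfl fun j hj => by simp [(mem_erase.1 hj).1]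
  rw [hs] at h
  simp only [PiLp.add_apply, PiLp.smul_apply, PiLp.single_apply, if_true, smul_eq_mul,
    mul_one] at h
  simp only [zero_smul, add_zero]
  linarith

theorem abs_betaC_le {lam g x : ℝ} (hlam : 0 < lam) :
    |betaC lam g x| ≤ max (g - lam) 0 + max (-g - lam) 0 := by
  unfold betaC
  grind

theorem abs_phiC_le {lam g x : ℝ} (hlam : 0 < lam) :
    |phiC lam g x| ≤ |x| + (max (g - lam) 0 + max (-g - lam) 0) := by
  unfold phiC sgn
  grind

theorem abs_phiC_le_of_pos {lam g x : ℝ} (hx : 0 < x) : |phiC lam g x| ≤ |g + lam| := by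
  unfold phiC sgn
  grind

theorem abs_phiC_le_of_neg {lam g x : ℝ} (hx : x < 0) : |phiC lam g x| ≤ |g - lam| := by
  unfold phiC sgn
  grind

/-- if `x_k → x*` and `x*` is a global minimizer of `F = f + λ‖·‖₁`,
then `β(x_k) → 0` and `φ(x_k) → 0`. -/
theorem stmt3 (n : ℕ) (hn : 1 ≤ n)
    (f : EuclideanSpace ℝ (Fin n) → ℝ)
    (hconv : ConvexOn ℝ Set.univ f) (hdiff : ContDiff ℝ 1 f)
    (lam : ℝ) (hlam : 0 < lam)
    (F : EuclideanSpace ℝ (Fin n) → ℝ)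
    (hF : ∀ x, F x = f x + lam * ∑ i, |x i|)
    (x : ℕ → EuclideanSpace ℝ (Fin n)) (xs : EuclideanSpace ℝ (Fin n))
    (hx : Tendsto x atTop (nhds xs))
    (hmin : ∀ z, F xs ≤ F z) :
    (∀ i : Fin n,
      Tendsto (fun k => betaC lam (gradient f (x k) i) (x k i)) atTop (nhds 0)) ∧
    (∀ i : Fin n,
      Tendsto (fun k => phiC lam (gradient f (x k) i) (x k i)) atTop (nhds 0)) := by
  have hgrad : ∀ i, Tendsto (fun k => gradient f (x k) i) atTop (nhds (gradient f xs i)) := fun i =>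
    ((EuclideanSpace.proj (𝕜 := ℝ) i).continuous.comp hdiff.continuous_gradient).continuousAt.tendsto.comp
      hx
  have hxi : ∀ i, Tendsto (fun k => x k i) atTop (nhds (xs i)) := fun i =>
    (EuclideanSpace.proj (𝕜 := ℝ) i).continuous.continuousAt.tendsto.comp hx
  have hopt := gradient_optimality_of_l1_penalty hlam
    (hdiff.differentiable one_ne_zero xs) fun z => by simpa only [hF] using hmin z
  have hexcess : ∀ i, Tendsto (fun k => max (gradient f (x k) i - lam) 0 +
      max (-gradient f (x k) i - lam) 0) atTop (nhds 0) := fun i => by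
    obtain ⟨h1, h2, -⟩ := hopt i
    have h := (((hgrad i).sub_const lam).max (tendsto_const_nhds (x := (0 : ℝ)))).add
      (((hgrad i).neg.sub_const lam).max (tendsto_const_nhds (x := (0 : ℝ))))
    rwa [max_eq_right (by linarith), max_eq_right (by linarith), add_zero] at h
  refine ⟨fun i => squeeze_zero_norm (fun k => abs_betaC_le hlam) (hexcess i), fun i => ?_⟩
  obtain ⟨-, -, hp, hn⟩ := hopt i
  rcases lt_trichotomy (xs i) 0 with hneg | hzero | hpos
  · refine squeeze_zero_norm' (a := fun k => |gradient f (x k) i - lam|) ?_ ?_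
    · filter_upwards [(hxi i).eventually_lt_const hneg] with k hk
      exact abs_phiC_le_of_neg hk
    · simpa [hn hneg] using ((hgrad i).sub_const lam).abs
  · refine squeeze_zero_norm (fun k => abs_phiC_le hlam) ?_
    simpa [hzero] using (hxi i).abs.add (hexcess i)
  · refine squeeze_zero_norm' (a := fun k => |gradient f (x k) i + lam|) ?_ ?_
    · filter_upwards [(hxi i).eventually_const_lt hpos] with k hk
      exact abs_phiC_le_of_pos hk
    · simpa [hp hpos] using ((hgrad i).add_const lam).abs
end

section
/- Let x ∈ ℝⁿ, let I be a set of indices such that for each i ∈ I one has x_i = 0 and β(x)_i ≠ 0, and define d ∈ ℝⁿ by d_i = −β(x)_i for i ∈ I and d_i = 0 for i ∉ I. Then for every real t with 0 ≤ t ≤ 1/L, F(x + t·d) ≤ F(x) − (t/2)·‖d‖², where ‖·‖ denotes the Euclidean norm. -/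
open Filter Finset

/-- Descent lemma: a function with `L`-Lipschitz gradient lies below its quadratic model. -/
theorem le_quadratic_of_lipschitz_gradient {E : Type*} [NormedAddCommGroup E]
    [InnerProductSpace ℝ E] [CompleteSpace E] {f : E → ℝ} (hdiff : Differentiable ℝ f) {L : ℝ}
    (hLip : ∀ a b : E, ‖gradient f a - gradient f b‖ ≤ L * ‖a - b‖) (x v : E) :
    f (x + v) ≤ f x + inner ℝ (gradient f x) v + L / 2 * ‖v‖ ^ 2 := by
  have hline (s : ℝ) : HasDerivAt (fun s : ℝ => f (x + s • v))
      (inner ℝ (gradient f (x + s • v)) v) s := by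
    have h1 : HasDerivAt (fun s : ℝ => x + s • v) v s := by
      simpa using ((hasDerivAt_id s).smul_const v).const_add x
    exact (hdiff (x + s • v)).hasGradientAt.hasFDerivAt.comp_hasDerivAt s h1
  have hmodel (s : ℝ) : HasDerivAt
      (fun s : ℝ => f x + s * inner ℝ (gradient f x) v + L / 2 * ‖v‖ ^ 2 * s ^ 2)
      (inner ℝ (gradient f x) v + L * ‖v‖ ^ 2 * s) s := by
    refine ((((hasDerivAt_id s).mul_const (inner ℝ (gradient f x) v)).const_add (f x)).add
      (((hasDerivAt_id s).pow 2).const_mul (L / 2 * ‖v‖ ^ 2))).congr_deriv ?_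
    simp
    ring
  have key := image_le_of_deriv_right_le_deriv_boundary (a := 0) (b := 1)
    (fun s _ => (hline s).continuousAt.continuousWithinAt)
    (fun s _ => (hline s).hasDerivWithinAt) (by simp)
    (fun s _ => (hmodel s).continuousAt.continuousWithinAt)
    (fun s _ => (hmodel s).hasDerivWithinAt) (fun s hs => ?_)
    (Set.right_mem_Icc.2 zero_le_one)
  · simpa using key
  · have h1 := hLip (x + s • v) x
    rw [add_sub_cancel_left, norm_smul, Real.norm_of_nonneg hs.1] at h1
    have h2 := real_inner_le_norm (gradient f (x + s • v) - gradient f x) v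
    rw [inner_sub_left] at h2
    nlinarith [mul_le_mul_of_nonneg_right h1 (norm_nonneg v)]

/-- At a zero variable, the linearized change of `g * s + lam * |s|` along `-betaC` is exactly
`-t * betaC ^ 2`. -/
theorem betaC_linear_decrease {lam g t : ℝ} (ht : 0 ≤ t) :
    g * (t * -betaC lam g 0) + lam * |t * -betaC lam g 0| = -t * (-betaC lam g 0) ^ 2 := by
  unfold betaC
  split_ifs with h1 h2
  · rw [abs_of_nonneg (mul_nonneg ht (by linarith [h1.2]))]
    ring
  · rw [abs_of_nonpos (mul_nonpos_of_nonneg_of_nonpos ht (by linarith [h2.2]))]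
    ring
  · simp

/-- with `d_i = -β(x)_i` on `I` (where `x_i = 0` and `β(x)_i ≠ 0`) and `d_i = 0`
off `I`, for every `0 ≤ t ≤ 1/L` one has `F(x + t·d) ≤ F(x) - (t/2)·‖d‖²`. -/
theorem stmt5 (n : ℕ) (hn : 1 ≤ n)
    (f : EuclideanSpace ℝ (Fin n) → ℝ)
    (hconv : ConvexOn ℝ Set.univ f) (hdiff : Differentiable ℝ f)
    (L : ℝ) (hL : 0 < L)
    (hLip : ∀ a b : EuclideanSpace ℝ (Fin n), ‖gradient f a - gradient f b‖ ≤ L * ‖a - b‖)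
    (lam : ℝ) (hlam : 0 < lam)
    (F : EuclideanSpace ℝ (Fin n) → ℝ)
    (hF : ∀ y, F y = f y + lam * ∑ i, |y i|)
    (x : EuclideanSpace ℝ (Fin n)) (I : Set (Fin n))
    (hI : ∀ i ∈ I, x i = 0 ∧ betaC lam (gradient f x i) (x i) ≠ 0)
    (d : EuclideanSpace ℝ (Fin n))
    (hdI : ∀ i ∈ I, d i = -betaC lam (gradient f x i) (x i))
    (hdO : ∀ i ∉ I, d i = 0) :
    ∀ t : ℝ, 0 ≤ t → t ≤ 1 / L → F (x + t • d) ≤ F x - t / 2 * ‖d‖ ^ 2 := by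
  intro t ht htL
  have hdesc := le_quadratic_of_lipschitz_gradient hdiff hLip x (t • d)
  have hcoord (i : Fin n) : gradient f x i * (t * d i) + lam * |x i + t * d i|
      = lam * |x i| - t * d i ^ 2 := by
    by_cases hi : i ∈ I
    · have hx := (hI i hi).1
      rw [hdI i hi, hx, zero_add, betaC_linear_decrease ht]
      simp
    · simp [hdO i hi]
  have hinner : inner ℝ (gradient f x) (t • d) = ∑ i, gradient f x i * (t * d i) := by
    rw [PiLp.inner_apply]
    exact Finset.sum_congr rfl fun i _ => mul_comm _ _
  have hsum : inner ℝ (gradient f x) (t • d) + lam * ∑ i, |x i + t * d i|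
      = lam * ∑ i, |x i| - t * ‖d‖ ^ 2 := by
    rw [hinner, EuclideanSpace.real_norm_sq_eq, Finset.mul_sum, Finset.mul_sum, Finset.mul_sum,
      ← Finset.sum_add_distrib, ← Finset.sum_sub_distrib]
    exact Finset.sum_congr rfl fun i _ => hcoord i
  have hquad : L / 2 * ‖t • d‖ ^ 2 ≤ t / 2 * ‖d‖ ^ 2 := by
    have hLt : L * t ≤ 1 := by
      rwa [le_div_iff₀ hL, mul_comm] at htL
    rw [norm_smul, Real.norm_of_nonneg ht]
    nlinarith [mul_le_mul_of_nonneg_right hLt (mul_nonneg ht (sq_nonneg ‖d‖))]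
  rw [hF, hF]
  simp only [PiLp.add_apply, PiLp.smul_apply, smul_eq_mul]
  linarith
end

section
/- Let x ∈ ℝⁿ, let I be a set of indices such that for each i ∈ I one has x_i = 0 and β(x)_i ≠ 0, and define d ∈ ℝⁿ by d_i = −β(x)_i for i ∈ I and d_i = 0 for i ∉ I. Let ξ ∈ (0,1) and η ∈ (0, 1/2]. Then the set J = { j ∈ ℕ : F(x + ξ^j·d) ≤ F(x) − η·ξ^j·‖d‖² } is nonempty, and its least element j* satisfies ξ^{j*} ≥ min{1, ξ/L}. -/
open Filter Finset

/-- The descent lemma for a function with Lipschitz gradient, along a ray. -/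
theorem descent_along_ray {E : Type*} [NormedAddCommGroup E] [InnerProductSpace ℝ E]
    [CompleteSpace E] {f : E → ℝ} (hdiff : Differentiable ℝ f) {L : ℝ}
    (hLip : ∀ a b : E, ‖gradient f a - gradient f b‖ ≤ L * ‖a - b‖)
    (x d : E) {t : ℝ} (ht : 0 ≤ t) :
    f (x + t • d) ≤ f x + t * inner ℝ (gradient f x) d + L / 2 * t ^ 2 * ‖d‖ ^ 2 := by
  have hderiv : ∀ s : ℝ, HasDerivAt
      (fun s : ℝ => f (x + s • d) - (s * inner ℝ (gradient f x) d + L / 2 * s ^ 2 * ‖d‖ ^ 2))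
      (inner ℝ (gradient f (x + s • d)) d - (inner ℝ (gradient f x) d + L * s * ‖d‖ ^ 2)) s := by
    intro s
    have hray : HasDerivAt (fun s : ℝ => x + s • d) d s := by
      simpa using ((hasDerivAt_id s).smul_const d).const_add x
    have hf := (hdiff (x + s • d)).hasGradientAt.hasFDerivAt.comp_hasDerivAt s hray
    have hquad : HasDerivAt
        (fun s : ℝ => s * inner ℝ (gradient f x) d + L / 2 * s ^ 2 * ‖d‖ ^ 2)
        (inner ℝ (gradient f x) d + L * s * ‖d‖ ^ 2) s := by
      refine (((hasDerivAt_id s).mul_const (inner ℝ (gradient f x) d)).add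
        (((hasDerivAt_pow 2 s).const_mul (L / 2)).mul_const (‖d‖ ^ 2))).congr_deriv ?_
      push_cast
      ring
    exact (hf.sub hquad).congr_deriv (by simp)
  have hanti := antitoneOn_of_deriv_nonpos (convex_Ici (0 : ℝ))
    (fun s _ => (hderiv s).continuousAt.continuousWithinAt)
    (fun s _ => (hderiv s).differentiableAt.differentiableWithinAt)
    (fun s hs => by
      rw [interior_Ici, Set.mem_Ioi] at hs
      rw [(hderiv s).deriv]
      have hcs := real_inner_le_norm (gradient f (x + s • d) - gradient f x) d
      rw [inner_sub_left] at hcs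
      have hgrad := hLip (x + s • d) x
      rw [add_sub_cancel_left, norm_smul, Real.norm_of_nonneg hs.le] at hgrad
      nlinarith [mul_le_mul_of_nonneg_right hgrad (norm_nonneg d)])
  have h := hanti Set.self_mem_Ici ht ht
  simp only [zero_smul, add_zero] at h
  linarith

theorem betaC_zero_mul_add_abs {lam g : ℝ} (hb : betaC lam g 0 ≠ 0) :
    g * -betaC lam g 0 + lam * |-betaC lam g 0| = -(-betaC lam g 0) ^ 2 := by
  unfold betaC at *
  split_ifs at * with h₁ h₂
  · rw [abs_of_pos (by linarith)]
    ring
  · rw [abs_of_neg (by linarith)]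
    ring
  · exact absurd rfl hb

/-- Backtracking that accepts every step size `ξ ^ j ≤ c` stops with one at least
`min 1 (ξ * c)`. -/
theorem nonempty_and_min_le_pow_sInf {ξ c : ℝ} (hξ0 : 0 < ξ) (hξ1 : ξ < 1) (hc : 0 < c)
    {J : Set ℕ} (hJ : ∀ j, ξ ^ j ≤ c → j ∈ J) :
    J.Nonempty ∧ min 1 (ξ * c) ≤ ξ ^ sInf J := by
  obtain ⟨j, hj⟩ := exists_pow_lt_of_lt_one hc hξ1
  refine ⟨⟨j, hJ j hj.le⟩, ?_⟩
  rcases h : sInf J with _ | k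
  · simp
  · have hk : c < ξ ^ k := by
      by_contra! hle
      have := Nat.sInf_le (hJ k hle)
      omega
    rw [pow_succ']
    exact (min_le_right _ _).trans (by gcongr)

/-- the backtracking set `J = {j : F(x + ξʲ·d) ≤ F(x) - η·ξʲ·‖d‖²}` is nonempty
and its least element `j*` satisfies `ξ^{j*} ≥ min{1, ξ/L}`. -/
theorem stmt7 (n : ℕ) (hn : 1 ≤ n)
    (f : EuclideanSpace ℝ (Fin n) → ℝ)
    (hconv : ConvexOn ℝ Set.univ f) (hdiff : Differentiable ℝ f)
    (L : ℝ) (hL : 0 < L)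
    (hLip : ∀ a b : EuclideanSpace ℝ (Fin n), ‖gradient f a - gradient f b‖ ≤ L * ‖a - b‖)
    (lam : ℝ) (hlam : 0 < lam)
    (F : EuclideanSpace ℝ (Fin n) → ℝ)
    (hF : ∀ y, F y = f y + lam * ∑ i, |y i|)
    (x : EuclideanSpace ℝ (Fin n)) (I : Set (Fin n))
    (hI : ∀ i ∈ I, x i = 0 ∧ betaC lam (gradient f x i) (x i) ≠ 0)
    (d : EuclideanSpace ℝ (Fin n))
    (hdI : ∀ i ∈ I, d i = -betaC lam (gradient f x i) (x i))
    (hdO : ∀ i ∉ I, d i = 0)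
    (ξ : ℝ) (hξ0 : 0 < ξ) (hξ1 : ξ < 1)
    (η : ℝ) (hη0 : 0 < η) (hη1 : η ≤ 1 / 2)
    (J : Set ℕ)
    (hJ : J = {j : ℕ | F (x + ξ ^ j • d) ≤ F x - η * ξ ^ j * ‖d‖ ^ 2}) :
    J.Nonempty ∧ min 1 (ξ / L) ≤ ξ ^ sInf J := by
  rw [div_eq_mul_inv]
  refine nonempty_and_min_le_pow_sInf hξ0 hξ1 (inv_pos.2 hL) fun j hj => ?_
  rw [hJ, Set.mem_ofPred_eq, hF, hF]
  have ht : 0 < ξ ^ j := pow_pos hξ0 j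
  generalize ξ ^ j = t at hj ht ⊢
  have hdesc := descent_along_ray hdiff hLip x d ht.le
  have hsum : t * inner ℝ (gradient f x) d + lam * ∑ i, |(x + t • d) i|
      = lam * ∑ i, |x i| - t * ‖d‖ ^ 2 := by
    rw [EuclideanSpace.real_norm_sq_eq, PiLp.inner_apply, mul_sum, mul_sum, mul_sum, mul_sum,
      ← sum_add_distrib, ← sum_sub_distrib]
    refine sum_congr rfl fun i _ => ?_
    simp only [PiLp.add_apply, PiLp.smul_apply, smul_eq_mul, RCLike.inner_apply, conj_trivial]
    by_cases hi : i ∈ I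
    · obtain ⟨hx, hb⟩ := hI i hi
      have hd := hdI i hi
      rw [hx] at hb hd
      have key := betaC_zero_mul_add_abs hb
      rw [← hd] at key
      rw [hx, zero_add, abs_mul, abs_of_pos ht, abs_zero]
      linear_combination t * key
    · simp [hdO i hi]
  have hLt : L * t ≤ 1 := by
    simpa [hL.ne'] using mul_le_mul_of_nonneg_left hj hL.le
  have htd : 0 ≤ t * ‖d‖ ^ 2 := by positivity
  nlinarith [mul_le_mul_of_nonneg_right hLt htd, mul_le_mul_of_nonneg_right hη1 htd]
end

section
/- Let x ∈ ℝⁿ, let I be a set of indices such that for each i ∈ I one has x_i = 0 and β(x)_i ≠ 0, and define d ∈ ℝⁿ by d_i = −β(x)_i for i ∈ I and d_i = 0 for i ∉ I. Let ξ ∈ (0,1), η ∈ (0,1/2], η_β ∈ (0,1], γ > 0, and suppose (Σ_{i∈I} β(x)_i²)^{1/2} ≥ η_β·‖β(x)‖ and ‖β(x)‖ ≥ γ·‖φ(x)‖. Let j* be the least j ∈ ℕ with F(x + ξ^j·d) ≤ F(x) − η·ξ^j·‖d‖² (such j* exists), and set x⁺ = x + ξ^{j*}·d. Then F(x⁺)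 ≤ F(x) − η·η_β²·min{1, ξ/L}·max{‖β(x)‖², γ²·‖φ(x)‖²}. -/
open Filter Finset

/-- Descent lemma: a function with `L`-Lipschitz gradient lies below its quadratic model. -/
theorem descent_of_lipschitz_gradient {E : Type*} [NormedAddCommGroup E] [InnerProductSpace ℝ E]
    [CompleteSpace E] {f : E → ℝ} (hdiff : Differentiable ℝ f) {L : ℝ}
    (hLip : ∀ a b, ‖gradient f a - gradient f b‖ ≤ L * ‖a - b‖) (x v : E) :
    f (x + v) ≤ f x + inner ℝ (gradient f x) v + L / 2 * ‖v‖ ^ 2 := by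
  let h : ℝ → ℝ := fun t => f (x + t • v) - t * inner ℝ (gradient f x) v - L / 2 * ‖v‖ ^ 2 * t ^ 2
  have hderiv (t : ℝ) : HasDerivAt h
      (inner ℝ (gradient f (x + t • v)) v - inner ℝ (gradient f x) v - L * ‖v‖ ^ 2 * t) t := by
    have hline : HasDerivAt (fun t : ℝ => x + t • v) v t := by
      simpa using ((hasDerivAt_id t).smul_const v).const_add x
    have hcomp := (hdiff (x + t • v)).hasGradientAt.hasFDerivAt.comp_hasDerivAt t hline
    have hlin := (hasDerivAt_id t).mul_const (inner ℝ (gradient f x) v)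
    have hquad := ((hasDerivAt_id t).pow 2).const_mul (L / 2 * ‖v‖ ^ 2)
    refine ((hcomp.sub hlin).sub hquad).congr_deriv ?_
    simp only [InnerProductSpace.toDual_apply_apply, id]
    push_cast
    ring
  have hanti : AntitoneOn h (Set.Icc 0 1) := by
    refine antitoneOn_of_deriv_nonpos (convex_Icc 0 1)
      (fun t _ => (hderiv t).continuousAt.continuousWithinAt)
      (fun t _ => (hderiv t).differentiableAt.differentiableWithinAt) fun t ht => ?_
    rw [interior_Icc] at ht
    rw [(hderiv t).deriv, ← inner_sub_left]
    have hinner := real_inner_le_norm (gradient f (x + t • v) - gradient f x) v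
    have hgrad := hLip (x + t • v) x
    rw [add_sub_cancel_left, norm_smul, Real.norm_of_nonneg ht.1.le] at hgrad
    nlinarith [mul_le_mul_of_nonneg_right hgrad (norm_nonneg v)]
  have hle := hanti (Set.left_mem_Icc.2 zero_le_one) (Set.right_mem_Icc.2 zero_le_one) zero_le_one
  simp only [h, one_smul, zero_smul, add_zero] at hle
  linarith

/-- Along the step `-betaC` the linearization of the objective decreases at rate `betaC ^ 2`. -/
theorem mul_neg_betaC_add (lam gi xi : ℝ) :
    gi * -betaC lam gi xi + lam * |betaC lam gi xi| = -betaC lam gi xi ^ 2 := by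
  unfold betaC
  split_ifs with h₁ h₂
  · rw [abs_of_neg h₁.2]; ring
  · rw [abs_of_pos h₂.2]; ring
  · simp

/-- sufficient decrease obtained by the backtracking line search along the
reduced `β`-step: `F(x⁺) ≤ F(x) - η·η_β²·min{1, ξ/L}·max{‖β(x)‖², γ²·‖φ(x)‖²}`. -/
theorem stmt8 (n : ℕ) (hn : 1 ≤ n)
    (f : EuclideanSpace ℝ (Fin n) → ℝ)
    (hconv : ConvexOn ℝ Set.univ f) (hdiff : Differentiable ℝ f)
    (L : ℝ) (hL : 0 < L)
    (hLip : ∀ a b : EuclideanSpace ℝ (Fin n), ‖gradient f a - gradient f b‖ ≤ L * ‖a - b‖)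
    (lam : ℝ) (hlam : 0 < lam)
    (F : EuclideanSpace ℝ (Fin n) → ℝ)
    (hF : ∀ y, F y = f y + lam * ∑ i, |y i|)
    (x : EuclideanSpace ℝ (Fin n)) (I : Finset (Fin n))
    (hI : ∀ i ∈ I, x i = 0 ∧ betaC lam (gradient f x i) (x i) ≠ 0)
    (d : EuclideanSpace ℝ (Fin n))
    (hdI : ∀ i ∈ I, d i = -betaC lam (gradient f x i) (x i))
    (hdO : ∀ i ∉ I, d i = 0)
    (ξ : ℝ) (hξ0 : 0 < ξ) (hξ1 : ξ < 1)
    (η : ℝ) (hη0 : 0 < η) (hη1 : η ≤ 1 / 2)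
    (ηβ : ℝ) (hηβ0 : 0 < ηβ) (hηβ1 : ηβ ≤ 1)
    (γ : ℝ) (hγ : 0 < γ)
    (Bnorm Pnorm : ℝ)
    (hB : Bnorm = Real.sqrt (∑ i, betaC lam (gradient f x i) (x i) ^ 2))
    (hP : Pnorm = Real.sqrt (∑ i, phiC lam (gradient f x i) (x i) ^ 2))
    (hsub : ηβ * Bnorm ≤ Real.sqrt (∑ i ∈ I, betaC lam (gradient f x i) (x i) ^ 2))
    (hrel : γ * Pnorm ≤ Bnorm)
    (J : Set ℕ)
    (hJ : J = {j : ℕ | F (x + ξ ^ j • d) ≤ F x - η * ξ ^ j * ‖d‖ ^ 2}) :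
    J.Nonempty ∧
      F (x + ξ ^ sInf J • d) ≤
        F x - η * ηβ ^ 2 * min 1 (ξ / L) * max (Bnorm ^ 2) (γ ^ 2 * Pnorm ^ 2) := by
  have hnorm : ‖d‖ ^ 2 = ∑ i ∈ I, betaC lam (gradient f x i) (x i) ^ 2 := by
    rw [EuclideanSpace.real_norm_sq_eq, ← Finset.sum_subset (Finset.subset_univ I)
      fun i _ hi => by rw [hdO i hi]; ring]
    exact Finset.sum_congr rfl fun i hi => by rw [hdI i hi]; ring
  have hlinear {α : ℝ} (hα : 0 ≤ α) :
      α * inner ℝ (gradient f x) d + lam * ∑ i, |(x + α • d) i| =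
        lam * ∑ i, |x i| - α * ‖d‖ ^ 2 := by
    rw [EuclideanSpace.real_norm_sq_eq, PiLp.inner_apply, Finset.mul_sum, Finset.mul_sum,
      Finset.mul_sum, Finset.mul_sum, ← Finset.sum_add_distrib, ← Finset.sum_sub_distrib]
    refine Finset.sum_congr rfl fun i _ => ?_
    by_cases hi : i ∈ I
    · have hβ := mul_neg_betaC_add lam (gradient f x i) (x i)
      simp only [PiLp.add_apply, PiLp.smul_apply, smul_eq_mul, hdI i hi, (hI i hi).1, zero_add,
        abs_mul, abs_neg, abs_of_nonneg hα, abs_zero, RCLike.inner_apply, conj_trivial] at hβ ⊢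
      linear_combination α * hβ
    · simp [hdO i hi]
  have hJ_iff (j : ℕ) : j ∈ J ↔ F (x + ξ ^ j • d) ≤ F x - η * ξ ^ j * ‖d‖ ^ 2 := by
    rw [hJ]; rfl
  have hmem (j : ℕ) (hj : ξ ^ j ≤ 1 / L) : j ∈ J := by
    have hα : 0 < ξ ^ j := pow_pos hξ0 j
    have hdesc := descent_of_lipschitz_gradient hdiff hLip x (ξ ^ j • d)
    rw [inner_smul_right, norm_smul, Real.norm_of_nonneg hα.le] at hdesc
    have hαL : ξ ^ j * L ≤ 1 := (le_div_iff₀ hL).1 hj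
    rw [hJ_iff, hF, hF]
    have hcoef : 0 ≤ ξ ^ j * ‖d‖ ^ 2 * (1 - η - ξ ^ j * L / 2) :=
      mul_nonneg (by positivity) (by linarith)
    linarith [hlinear hα.le]
  obtain ⟨hne, hstep⟩ := nonempty_and_min_le_pow_sInf hξ0 hξ1 (one_div_pos.2 hL) hmem
  rw [mul_one_div] at hstep
  refine ⟨hne, ?_⟩
  have hdec : F (x + ξ ^ sInf J • d) ≤ F x - η * ξ ^ sInf J * ‖d‖ ^ 2 :=
    (hJ_iff _).1 (Nat.sInf_mem hne)
  have hB0 : 0 ≤ Bnorm := hB ▸ Real.sqrt_nonneg _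
  have hP0 : 0 ≤ Pnorm := hP ▸ Real.sqrt_nonneg _
  have hmax : max (Bnorm ^ 2) (γ ^ 2 * Pnorm ^ 2) = Bnorm ^ 2 := by
    rw [← mul_pow]
    exact max_eq_left (pow_le_pow_left₀ (by positivity) hrel 2)
  have hd : (ηβ * Bnorm) ^ 2 ≤ ‖d‖ ^ 2 := by
    rw [← hnorm, Real.sqrt_sq (norm_nonneg d)] at hsub
    exact pow_le_pow_left₀ (by positivity) hsub 2
  rw [hmax]
  have hprod := mul_le_mul_of_nonneg_left
    (mul_le_mul hstep hd (by positivity) (pow_pos hξ0 _).le) hη0.le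
  linarith
end

section
/- For every x ∈ ℝⁿ, shrink(x − ∇f(x)) − x = −(β(x) + φ(x)). -/
open Filter Finset

/-- componentwise shrinkage (soft-thresholding) operator. -/
noncomputable def shrinkC (lam z : ℝ) : ℝ :=
  if z < -lam then z + lam else if z ≤ lam then 0 else z - lam

theorem shrinkC_sub_sub_self {lam : ℝ} (hlam : 0 < lam) (g x : ℝ) :
    shrinkC lam (x - g) - x = -(betaC lam g x + phiC lam g x) := by
  unfold shrinkC betaC phiC sgn
  grind

/-- the full ISTA step satisfies `shrink(x - ∇f(x)) - x = -(β(x) + φ(x))`. -/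
theorem stmt12 (n : ℕ) (hn : 1 ≤ n)
    (f : EuclideanSpace ℝ (Fin n) → ℝ) (hdiff : Differentiable ℝ f)
    (lam : ℝ) (hlam : 0 < lam) :
    ∀ x : EuclideanSpace ℝ (Fin n), ∀ i : Fin n,
      shrinkC lam (x i - gradient f x i) - x i
        = -(betaC lam (gradient f x i) (x i) + phiC lam (gradient f x i) (x i)) := by
  intro x i
  exact shrinkC_sub_sub_self hlam _ _
end

section
/- Let x, d ∈ ℝⁿ satisfy sgn(x_i + d_i) = sgn(x_i) for every index i. Then for every α ∈ [0,1], F(x + α·d) ≤ F(x) + α·⟨∇f(x) + λ·sgn(x), d⟩ + (θ_max/2)·α²·‖d‖², where sgn is applied componentwise, ⟨·,·⟩ is the Euclidean inner product, and ‖·‖ is the Euclidean norm. -/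
open Finset

theorem le_quadratic_of_hasDerivAt_le {φ φ' φ'' : ℝ → ℝ} {C : ℝ}
    (hφ : ∀ t, HasDerivAt φ (φ' t) t) (hφ' : ∀ t, HasDerivAt φ' (φ'' t) t)
    (hC : ∀ t, φ'' t ≤ C) {t : ℝ} (ht : 0 ≤ t) :
    φ t ≤ φ 0 + t * φ' 0 + C / 2 * t ^ 2 := by
  have hlin : ∀ s, 0 ≤ s → φ' s - φ' 0 ≤ C * (s - 0) := fun s hs =>
    image_sub_le_mul_sub_of_deriv_le (fun u => (hφ' u).differentiableAt)
      (fun u => (hφ' u).deriv.trans_le (hC u)) hs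
  have hψ : ∀ s, HasDerivAt (fun s => φ s - s * φ' 0 - C / 2 * s ^ 2)
      (φ' s - φ' 0 - C * s) s := fun s => by
    refine (((hφ s).sub ((hasDerivAt_id s).mul_const (φ' 0))).sub
      ((hasDerivAt_pow 2 s).const_mul (C / 2))).congr_deriv ?_
    simp only [Nat.cast_ofNat, Nat.add_one_sub_one, pow_one]
    ring
  have hanti : AntitoneOn (fun s => φ s - s * φ' 0 - C / 2 * s ^ 2) (Set.Ici 0) := by
    refine antitoneOn_of_deriv_nonpos (convex_Ici 0)
      (fun s _ => (hψ s).continuousAt.continuousWithinAt)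
      (fun s _ => (hψ s).differentiableAt.differentiableWithinAt) fun s hs => ?_
    rw [interior_Ici] at hs
    rw [(hψ s).deriv]
    linarith [hlin s (le_of_lt hs)]
  have h := hanti (Set.mem_Ici.2 le_rfl) (Set.mem_Ici.2 ht) ht
  norm_num at h
  linarith

theorem ContDiff.le_quadratic_of_fderiv_fderiv_le {E : Type*} [NormedAddCommGroup E]
    [NormedSpace ℝ E] {f : E → ℝ} (hf : ContDiff ℝ 2 f) {x d : E} {C : ℝ}
    (hC : ∀ y, fderiv ℝ (fderiv ℝ f) y d d ≤ C) {t : ℝ} (ht : 0 ≤ t) :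
    f (x + t • d) ≤ f x + t * fderiv ℝ f x d + C / 2 * t ^ 2 := by
  have hline : ∀ s : ℝ, HasDerivAt (fun s : ℝ => x + s • d) d s := fun s => by
    simpa using ((hasDerivAt_id s).smul_const d).const_add x
  have hf' : Differentiable ℝ (fderiv ℝ f) :=
    (hf.fderiv_right (m := 1) (by norm_num)).differentiable (by norm_num)
  have h := le_quadratic_of_hasDerivAt_le (φ := fun s => f (x + s • d))
    (fun s => ((hf.differentiable (by norm_num)) _).hasFDerivAt.comp_hasDerivAt s (hline s))
    (fun s => ((hf' _).hasFDerivAt.comp_hasDerivAt s (hline s)).clm_apply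
      (hasDerivAt_const s d))
    (C := C) (fun s => by simpa using hC (x + s • d)) ht
  simpa using h

theorem abs_add_mul_eq_of_sgn_eq {a b t : ℝ} (h : sgn (a + b) = sgn a)
    (ht₀ : 0 ≤ t) (ht₁ : t ≤ 1) : |a + t * b| = |a| + t * (sgn a * b) := by
  rcases lt_trichotomy a 0 with ha | rfl | ha
  · have hab : a + b < 0 := by
      simp only [sgn] at h
      split_ifs at h <;> linarith
    have : a + t * b ≤ 0 := by nlinarith
    rw [abs_of_nonpos this, abs_of_neg ha, sgn, if_neg ha.not_gt, if_pos ha]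
    ring
  · have hb : b = 0 := by
      simp only [sgn] at h
      split_ifs at h <;> linarith
    simp [hb]
  · have hab : 0 < a + b := by
      simp only [sgn] at h
      split_ifs at h <;> linarith
    have : 0 ≤ a + t * b := by nlinarith
    rw [abs_of_nonneg this, abs_of_pos ha, sgn, if_pos ha]
    ring

/-- if `sgn(x_i + d_i) = sgn(x_i)` for all `i`, then for all `α ∈ [0,1]`,
`F(x + α·d) ≤ F(x) + α·⟨∇f(x) + λ·sgn(x), d⟩ + (θ_max/2)·α²·‖d‖²`. -/
theorem stmt14 (n : ℕ) (hn : 1 ≤ n)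
    (f : EuclideanSpace ℝ (Fin n) → ℝ) (hdiff : ContDiff ℝ 2 f)
    (θmax : ℝ) (hθ : 0 < θmax)
    (hH : ∀ y v : EuclideanSpace ℝ (Fin n), (fderiv ℝ (fderiv ℝ f) y) v v ≤ θmax * ‖v‖ ^ 2)
    (lam : ℝ) (hlam : 0 < lam)
    (F : EuclideanSpace ℝ (Fin n) → ℝ)
    (hF : ∀ y, F y = f y + lam * ∑ i, |y i|)
    (x d : EuclideanSpace ℝ (Fin n))
    (hsgn : ∀ i : Fin n, sgn (x i + d i) = sgn (x i)) :
    ∀ α : ℝ, 0 ≤ α → α ≤ 1 →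
      F (x + α • d) ≤
        F x + α * (∑ i, (gradient f x i + lam * sgn (x i)) * d i)
          + θmax / 2 * α ^ 2 * ‖d‖ ^ 2 := by
  intro α hα₀ hα₁
  have hf := hdiff.le_quadratic_of_fderiv_fderiv_le (x := x) (fun y => hH y d) hα₀
  have hgrad : fderiv ℝ f x d = ∑ i, gradient f x i * d i := by
    rw [← inner_gradient_left, PiLp.inner_apply]
    simp [mul_comm]
  have habs : ∑ i, |(x + α • d) i| = ∑ i, |x i| + α * ∑ i, sgn (x i) * d i := by
    rw [Finset.mul_sum, ← Finset.sum_add_distrib]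
    exact Finset.sum_congr rfl fun i _ => abs_add_mul_eq_of_sgn_eq (hsgn i) hα₀ hα₁
  have hsum : ∑ i, (gradient f x i + lam * sgn (x i)) * d i =
      fderiv ℝ f x d + lam * ∑ i, sgn (x i) * d i := by
    rw [hgrad, Finset.mul_sum, ← Finset.sum_add_distrib]
    exact Finset.sum_congr rfl fun i _ => by ring
  rw [hF, hF, habs, hsum]
  linarith
end
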